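/- Fix σ_ε ≥ 0, σ_0 ≥ 0, ρ_1 ∈ (0,1), ρ_2 ∈ (0,1) with Φ_0 = σ_ε²(1−ρ_1) + σ_0²(1−ρ_2) > 0, and z > 0. Let Q_1 ~ N(0, ρ_1) and Q_2 ~ N(0, ρ_2) be independent. For q_1, q_2 ∈ ℝ and τ > 0 set μ_0(q_1,q_2) = σ_ε q_1 + σ_0 q_2, m(τ,q_1,q_2) = σ_ε q_1 + q_2√(σ_0² + τ²), v(τ) = σ_ε²(1−ρ_1) + (σ_0² + τ²)(1−ρ_2), and T_NP(τ,q_1,q_2) = Φ((μ_0 + z√Φ_0 − m)/√v) − Φ((μ_0 − z√Φ_0 − m)/√v). Then lim_{τ→∞} τ·E_{Q_1,Q_2}[T_NP(τ, Q_1, Q_2)] = 2z√Φ_0/√(2π). -/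

import Mathlib

open MeasureTheory ProbabilityTheory Filter

/-- The standard normal cumulative distribution function `Φ`. -/
noncomputable def stdGaussCDF (x : ℝ) : ℝ :=
  ((gaussianReal 0 1) (Set.Iic x)).toReal

open Topology

lemma stdGaussCDF_eq_integral (x : ℝ) :
    stdGaussCDF x = ∫ t in Set.Iic x, gaussianPDFReal 0 1 t := by
  rw [stdGaussCDF, gaussianReal_apply_eq_integral 0 one_ne_zero, ENNReal.toReal_ofReal]
  exact integral_nonneg fun t => gaussianPDFReal_nonneg 0 1 t

lemma hasDerivAt_stdGaussCDF (x : ℝ) :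
    HasDerivAt stdGaussCDF (gaussianPDFReal 0 1 x) x := by
  have hcont : Continuous (gaussianPDFReal 0 1) := by
    rw [gaussianPDFReal_def]
    fun_prop
  have hint : Integrable (gaussianPDFReal 0 1) := integrable_gaussianPDFReal 0 1
  have heq : stdGaussCDF =
      fun y => stdGaussCDF 0 + ∫ t in (0 : ℝ)..y, gaussianPDFReal 0 1 t := by
    funext y
    rw [← intervalIntegral.integral_Iic_sub_Iic hint.integrableOn hint.integrableOn,
      ← stdGaussCDF_eq_integral, ← stdGaussCDF_eq_integral]
    ring
  rw [heq]
  exact (intervalIntegral.integral_hasDerivAt_right hint.intervalIntegrable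
    (hcont.stronglyMeasurableAtFilter _ _) hcont.continuousAt).const_add _

lemma measurable_stdGaussCDF : Measurable stdGaussCDF :=
  (continuous_iff_continuousAt.2 fun x => (hasDerivAt_stdGaussCDF x).continuousAt).measurable

lemma norm_stdGaussCDF_le_one (x : ℝ) : ‖stdGaussCDF x‖ ≤ 1 := by
  rw [stdGaussCDF, Real.norm_of_nonneg ENNReal.toReal_nonneg]
  exact measureReal_le_one

lemma gaussianReal_real_Iic (w : ℝ) (hw : 0 < w) (v : NNReal) (hv : (v : ℝ) = w ^ 2) (x : ℝ) :
    (gaussianReal 0 v).real (Set.Iic x) = stdGaussCDF (x / w) := by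
  have hmap : (gaussianReal 0 1).map (w * ·) = gaussianReal 0 v := by
    rw [gaussianReal_map_const_mul, mul_zero]
    congr 1
    ext
    simp [hv]
  rw [← hmap, map_measureReal_apply (by fun_prop) measurableSet_Iic, stdGaussCDF, Measure.real]
  congr 2
  ext y
  simp [le_div_iff₀ hw, mul_comm]

/-- Averaging `Φ((b q + c) / k)` over a centred Gaussian `q` gives `Φ` at a rescaled point. -/
lemma integral_stdGaussCDF_gaussianReal (b c k : ℝ) (hk : 0 < k) (v : NNReal) :
    ∫ q, stdGaussCDF ((b * q + c) / k) ∂(gaussianReal 0 v) =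
      stdGaussCDF (c / √(k ^ 2 + b ^ 2 * v)) := by
  have hpos : 0 < k ^ 2 + b ^ 2 * (v : ℝ) := by positivity
  rw [← gaussianReal_real_Iic √(k ^ 2 + b ^ 2 * v) (Real.sqrt_pos.2 hpos)
    (NNReal.mk (b ^ 2) (sq_nonneg b) * v + NNReal.mk (k ^ 2) (sq_nonneg k))
    (by rw [Real.sq_sqrt hpos.le]; push_cast; exact add_comm _ _)]
  have hconv : gaussianReal 0
      (NNReal.mk (b ^ 2) (sq_nonneg b) * v + NNReal.mk (k ^ 2) (sq_nonneg k)) =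
      ((gaussianReal 0 v).map (-b * ·)).conv
        (gaussianReal 0 (NNReal.mk (k ^ 2) (sq_nonneg k))) := by
    rw [gaussianReal_map_const_mul, gaussianReal_conv_gaussianReal]
    congr 1
    · ring
    · ext
      simp
  have hlin : gaussianReal 0
      (NNReal.mk (b ^ 2) (sq_nonneg b) * v + NNReal.mk (k ^ 2) (sq_nonneg k))
      (Set.Iic c) =
      ∫⁻ q, ENNReal.ofReal (stdGaussCDF ((b * q + c) / k)) ∂(gaussianReal 0 v) := by
    rw [hconv, ← lintegral_indicator_one measurableSet_Iic,
      Measure.lintegral_conv (measurable_one.indicator measurableSet_Iic),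
      lintegral_map (Measurable.lintegral_prod_right'
        (f := fun p : ℝ × ℝ => (Set.Iic c).indicator 1 (p.1 + p.2))
        ((measurable_one.indicator measurableSet_Iic).comp (by fun_prop))) (by fun_prop)]
    refine lintegral_congr fun q => ?_
    rw [← gaussianReal_real_Iic k hk (NNReal.mk (k ^ 2) (sq_nonneg k)) rfl, ofReal_measureReal,
      ← lintegral_indicator_one measurableSet_Iic]
    refine lintegral_congr fun y => ?_
    simp [Set.indicator_apply]
  rw [Measure.real, hlin, integral_eq_lintegral_of_nonneg_ae
    (f := fun q => stdGaussCDF ((b * q + c) / k)) (ae_of_all _ fun q => ENNReal.toReal_nonneg)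
    (measurable_stdGaussCDF.comp (by fun_prop)).aestronglyMeasurable]

/-- First-order expansion of the symmetric increment `Φ(x) - Φ(-x)` at zero. -/
lemma tendsto_mul_stdGaussCDF_sub {g : ℝ → ℝ} {c : ℝ}
    (hg : Tendsto (fun τ => τ * g τ) atTop (𝓝 c)) :
    Tendsto (fun τ => τ * (stdGaussCDF (g τ) - stdGaussCDF (-g τ))) atTop
      (𝓝 (2 * c / √(2 * Real.pi))) := by
  have hd : HasDerivAt (fun x => stdGaussCDF x - stdGaussCDF (-x))
      (2 * (√(2 * Real.pi))⁻¹) 0 := by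
    have hneg : HasDerivAt stdGaussCDF (gaussianPDFReal 0 1 0) (-0) := by
      simpa using hasDerivAt_stdGaussCDF 0
    refine ((hasDerivAt_stdGaussCDF 0).sub
      (hneg.comp (0 : ℝ) (hasDerivAt_neg (0 : ℝ)))).congr_deriv ?_
    simp only [gaussianPDFReal, NNReal.coe_one, mul_one, sub_zero, ne_eq, OfNat.ofNat_ne_zero,
      not_false_eq_true, zero_pow, neg_zero, zero_div, Real.exp_zero]
    ring
  have hg0 : Tendsto g atTop (𝓝 0) := by
    have h := tendsto_inv_atTop_zero.mul hg
    rw [zero_mul] at h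
    refine h.congr' ?_
    filter_upwards [eventually_gt_atTop 0] with τ hτ
    rw [inv_mul_cancel_left₀ hτ.ne']
  have hlim := hd.hasFDerivAt.hasFDerivWithinAt.lim hg0
    (.of_forall fun _ => Set.mem_univ _) hg
  convert hlim using 2
  · simp
  · simp
    ring

/-- Result 2, part 3: the expected type II error of the conditional Neyman–Pearson
test satisfies `τ·E[T_NP(τ, Q₁, Q₂)] → 2z√Φ₀/√(2π)` as `τ → ∞`, where
`T_NP(τ,q₁,q₂) = Φ((μ₀+z√Φ₀-m)/√v) - Φ((μ₀-z√Φ₀-m)/√v)` with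
`μ₀ = σ_ε q₁ + σ₀ q₂`, `m = σ_ε q₁ + q₂√(σ₀²+τ²)`,
`v = σ_ε²(1-ρ₁) + (σ₀²+τ²)(1-ρ₂)`, and `Q₁ ~ N(0,ρ₁)`, `Q₂ ~ N(0,ρ₂)` independent. -/
theorem expected_typeII_NP
    {Ω : Type*} [MeasureSpace Ω] [IsProbabilityMeasure (ℙ : Measure Ω)]
    (σε σ₀ : ℝ) (hσε : 0 ≤ σε) (hσ₀ : 0 ≤ σ₀)
    (ρ₁ ρ₂ : ℝ) (hρ₁ : ρ₁ ∈ Set.Ioo (0 : ℝ) 1) (hρ₂ : ρ₂ ∈ Set.Ioo (0 : ℝ) 1)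
    (Φ₀ : ℝ) (hΦ₀def : Φ₀ = σε ^ 2 * (1 - ρ₁) + σ₀ ^ 2 * (1 - ρ₂)) (hΦ₀ : 0 < Φ₀)
    (z : ℝ) (hz : 0 < z)
    (Q₁ Q₂ : Ω → ℝ) (hQ₁meas : Measurable Q₁) (hQ₂meas : Measurable Q₂)
    (hQ₁ : Measure.map Q₁ ℙ = gaussianReal 0 (Real.toNNReal ρ₁))
    (hQ₂ : Measure.map Q₂ ℙ = gaussianReal 0 (Real.toNNReal ρ₂))
    (hindep : ProbabilityTheory.IndepFun Q₁ Q₂ ℙ)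
    (μ₀ : ℝ → ℝ → ℝ) (m : ℝ → ℝ → ℝ → ℝ) (v : ℝ → ℝ) (TNP : ℝ → ℝ → ℝ → ℝ)
    (hμ₀ : ∀ q₁ q₂, μ₀ q₁ q₂ = σε * q₁ + σ₀ * q₂)
    (hm : ∀ τ q₁ q₂, m τ q₁ q₂ = σε * q₁ + q₂ * Real.sqrt (σ₀ ^ 2 + τ ^ 2))
    (hv : ∀ τ, v τ = σε ^ 2 * (1 - ρ₁) + (σ₀ ^ 2 + τ ^ 2) * (1 - ρ₂))
    (hTNP : ∀ τ q₁ q₂, TNP τ q₁ q₂ =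
      stdGaussCDF ((μ₀ q₁ q₂ + z * Real.sqrt Φ₀ - m τ q₁ q₂) / Real.sqrt (v τ)) -
        stdGaussCDF ((μ₀ q₁ q₂ - z * Real.sqrt Φ₀ - m τ q₁ q₂) / Real.sqrt (v τ))) :
    Tendsto (fun τ => τ * ∫ ω, TNP τ (Q₁ ω) (Q₂ ω) ∂ℙ) atTop
      (nhds (2 * z * Real.sqrt Φ₀ / Real.sqrt (2 * Real.pi))) := by
  obtain ⟨hρ₂0, hρ₂1⟩ := hρ₂
  set c := z * √Φ₀ with hc
  set s : ℝ → ℝ := fun τ => √(σ₀ ^ 2 + τ ^ 2) with hs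
  set w : ℝ → ℝ := fun τ => √(v τ + (σ₀ - s τ) ^ 2 * ρ₂) with hw
  have hvpos : ∀ τ, 0 < v τ := fun τ => by
    rw [hv]
    nlinarith [mul_nonneg (sq_nonneg τ) (sub_nonneg.2 hρ₂1.le)]
  have hcdf : ∀ τ x, ∫ ω, stdGaussCDF (((σ₀ - s τ) * Q₂ ω + x) / √(v τ)) ∂ℙ =
      stdGaussCDF (x / w τ) := fun τ x => by
    rw [← integral_map (f := fun q => stdGaussCDF (((σ₀ - s τ) * q + x) / √(v τ)))
      hQ₂meas.aemeasurable (measurable_stdGaussCDF.comp (by fun_prop)).aestronglyMeasurable,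
      hQ₂, integral_stdGaussCDF_gaussianReal _ _ _ (Real.sqrt_pos.2 (hvpos τ)),
      Real.sq_sqrt (hvpos τ).le, Real.coe_toNNReal _ hρ₂0.le]
  have hint : ∀ τ x,
      Integrable (fun ω => stdGaussCDF (((σ₀ - s τ) * Q₂ ω + x) / √(v τ))) ℙ := fun τ x =>
    .of_bound (measurable_stdGaussCDF.comp (by fun_prop)).aestronglyMeasurable 1
      (ae_of_all _ fun ω => norm_stdGaussCDF_le_one _)
  have hexp : ∀ τ, ∫ ω, TNP τ (Q₁ ω) (Q₂ ω) ∂ℙ =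
      stdGaussCDF (c / w τ) - stdGaussCDF (-(c / w τ)) := fun τ => by
    rw [← neg_div, ← hcdf, ← hcdf, ← integral_sub (hint τ c) (hint τ (-c))]
    refine integral_congr_ae (ae_of_all _ fun ω => ?_)
    simp only [hTNP, hμ₀, hm, hs, hc]
    ring_nf
  have hw_lim : Tendsto (fun τ => w τ / τ) atTop (𝓝 1) := by
    have hcont : Continuous fun u : ℝ =>
        √(σε ^ 2 * (1 - ρ₁) * u ^ 2 + (σ₀ ^ 2 * u ^ 2 + 1) * (1 - ρ₂) +
          (σ₀ * u - √(σ₀ ^ 2 * u ^ 2 + 1)) ^ 2 * ρ₂) := by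
      fun_prop
    have h := (hcont.tendsto 0).comp tendsto_inv_atTop_zero
    simp only [ne_eq, OfNat.ofNat_ne_zero, not_false_eq_true, zero_pow, mul_zero, zero_add,
      Real.sqrt_one, zero_sub, even_two, Even.neg_pow, one_pow, one_mul, sub_add_cancel] at h
    refine h.congr' ?_
    filter_upwards [eventually_gt_atTop 0] with τ hτ
    have hsτ : s τ = τ * √(σ₀ ^ 2 * τ⁻¹ ^ 2 + 1) := by
      rw [← Real.sqrt_sq hτ.le, ← Real.sqrt_mul (sq_nonneg τ), Real.sqrt_sq hτ.le]
      simp only [hs]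
      congr 1
      field_simp
    rw [eq_div_iff hτ.ne', mul_comm, Function.comp_apply]
    nth_rewrite 1 [← Real.sqrt_sq hτ.le]
    rw [← Real.sqrt_mul (sq_nonneg τ)]
    simp only [hw, hsτ, hv]
    congr 1
    field_simp
  have hg : Tendsto (fun τ => τ * (c / w τ)) atTop (𝓝 c) := by
    have h := (hw_lim.inv₀ one_ne_zero).const_mul c
    rw [inv_one, mul_one] at h
    refine h.congr fun τ => ?_
    rw [inv_div]
    ring
  simpa only [hexp, hc, mul_assoc] using tendsto_mul_stdGaussCDF_sub hg
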